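/- arXiv:1909.07291 — 2 statements merged into one kernel-verified Lean document; each statement's English description precedes it below -/
import Mathlib

section
/- Let n > 0 and a be real constants and P : (−1,1) → ℝ a C², strictly positive function. On the region U = {x ∈ ℝ³ : r > 0, 0 < θ < π} define, with μ = cos θ, the Cartesian vector fields A = A_θ e_θ + A_φ e_φ and B = B_r e_r + B_θ e_θ + B_φ e_φ, where A_θ = −(a/n) P(μ)^{(n+1)/n} / (r^{n+1} sin θ), A_φ = P(μ) / (r^{n+1} sin θ), B_r = −P'(μ)/r^{n+2}, B_θ = n P(μ) / (r^{n+2} sin θ), B_φ = a P(μ)^{(n+1)/n} / (r^{n+2} sin θ). Then ∇×A = B on U, and A·B = 0 everywhere on U. -/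
noncomputable section

/-- Vectors in ℝ³. -/
abbrev V3 := Fin 3 → ℝ

/-- Euclidean dot product on ℝ³. -/
def dot3 (a b : V3) : ℝ := a 0 * b 0 + a 1 * b 1 + a 2 * b 2

/-- Cross product on ℝ³. -/
def cross3 (a b : V3) : V3 :=
  ![a 1 * b 2 - a 2 * b 1, a 2 * b 0 - a 0 * b 2, a 0 * b 1 - a 1 * b 0]

/-- Euclidean norm on ℝ³. -/
def norm3 (a : V3) : ℝ := Real.sqrt (dot3 a a)

/-- Partial derivative of a scalar field in the `i`-th Cartesian direction. -/
def pd (i : Fin 3) (f : V3 → ℝ) (x : V3) : ℝ := fderiv ℝ f x (Pi.single i 1)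

/-- Gradient of a scalar field. -/
def grad3 (f : V3 → ℝ) (x : V3) : V3 := fun i => pd i f x

/-- Divergence of a vector field. -/
def div3 (F : V3 → V3) (x : V3) : ℝ :=
  pd 0 (fun y => F y 0) x + pd 1 (fun y => F y 1) x + pd 2 (fun y => F y 2) x

/-- Curl of a vector field. -/
def curl3 (F : V3 → V3) (x : V3) : V3 :=
  ![pd 1 (fun y => F y 2) x - pd 2 (fun y => F y 1) x,
    pd 2 (fun y => F y 0) x - pd 0 (fun y => F y 2) x,
    pd 0 (fun y => F y 1) x - pd 1 (fun y => F y 0) x]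

/-- Directional derivative `(v·∇)F` of a vector field. -/
def dirD3 (v : V3) (F : V3 → V3) (x : V3) : V3 :=
  fun i => v 0 * pd 0 (fun y => F y i) x + v 1 * pd 1 (fun y => F y i) x
    + v 2 * pd 2 (fun y => F y i) x

/-- Spherical radius `r`. -/
def rr (x : V3) : ℝ := Real.sqrt (x 0 ^ 2 + x 1 ^ 2 + x 2 ^ 2)

/-- Cylindrical radius `ρ = r sin θ`. -/
def ρ3 (x : V3) : ℝ := Real.sqrt (x 0 ^ 2 + x 1 ^ 2)

/-- `μ = cos θ = z/r`. -/
def μ3 (x : V3) : ℝ := x 2 / rr x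

/-- `sin θ = ρ/r`. -/
def sθ3 (x : V3) : ℝ := ρ3 x / rr x

/-- Radial unit vector `e_r`. -/
def er (x : V3) : V3 := (rr x)⁻¹ • x

/-- Polar unit vector `e_θ = (cosθ cosφ, cosθ sinφ, −sinθ)`. -/
def eθ (x : V3) : V3 :=
  ![x 2 * x 0 / (rr x * ρ3 x), x 2 * x 1 / (rr x * ρ3 x), -(ρ3 x) / rr x]

/-- Azimuthal unit vector `e_φ = (−sinφ, cosφ, 0)`. -/
def eφ (x : V3) : V3 := ![-(x 1) / ρ3 x, x 0 / ρ3 x, 0]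

/-- `f` is differentiable at `x`, with gradient `p`. -/
def HasGrad3 (f : V3 → ℝ) (p : V3) (x : V3) : Prop :=
  DifferentiableAt ℝ f x ∧ ∀ i, pd i f x = p i

namespace HasGrad3

variable {f g : V3 → ℝ} {p q x : V3}

lemma coord (j : Fin 3) (x : V3) : HasGrad3 (fun y => y j) (Pi.single j 1) x := by
  have h : HasFDerivAt (fun y : V3 => y j) (ContinuousLinearMap.proj (R := ℝ) j) x :=
    hasFDerivAt_apply j x
  refine ⟨h.differentiableAt, fun i => ?_⟩
  rw [pd, h.fderiv, ContinuousLinearMap.proj_apply, Pi.single_comm]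

lemma add (hf : HasGrad3 f p x) (hg : HasGrad3 g q x) :
    HasGrad3 (fun y => f y + g y) (p + q) x := by
  refine ⟨hf.1.fun_add hg.1, fun i => ?_⟩
  rw [pd, fderiv_fun_add hf.1 hg.1, Pi.add_apply, ← hf.2, ← hg.2]
  rfl

lemma sub (hf : HasGrad3 f p x) (hg : HasGrad3 g q x) :
    HasGrad3 (fun y => f y - g y) (p - q) x := by
  refine ⟨hf.1.fun_sub hg.1, fun i => ?_⟩
  rw [pd, fderiv_fun_sub hf.1 hg.1, Pi.sub_apply, ← hf.2, ← hg.2]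
  rfl

lemma neg (hf : HasGrad3 f p x) : HasGrad3 (fun y => -f y) (-p) x := by
  refine ⟨hf.1.fun_neg, fun i => ?_⟩
  rw [pd, fderiv_fun_neg, Pi.neg_apply, ← hf.2]
  rfl

lemma mul (hf : HasGrad3 f p x) (hg : HasGrad3 g q x) :
    HasGrad3 (fun y => f y * g y) (f x • q + g x • p) x := by
  refine ⟨hf.1.fun_mul hg.1, fun i => ?_⟩
  rw [pd, fderiv_fun_mul hf.1 hg.1, Pi.add_apply, Pi.smul_apply, Pi.smul_apply, ← hf.2, ← hg.2]
  rfl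

lemma comp {u : ℝ → ℝ} {u' : ℝ} (hu : HasDerivAt u u' (f x)) (hf : HasGrad3 f p x) :
    HasGrad3 (fun y => u (f y)) (u' • p) x := by
  have h := hu.comp_hasFDerivAt x hf.1.hasFDerivAt
  refine ⟨h.differentiableAt, fun i => ?_⟩
  rw [Pi.smul_apply, ← hf.2]
  exact congrArg (fun L => L (Pi.single i 1)) h.fderiv

lemma inv (hf : HasGrad3 f p x) (h0 : f x ≠ 0) :
    HasGrad3 (fun y => (f y)⁻¹) ((-(f x ^ 2)⁻¹) • p) x :=
  comp (hasDerivAt_inv h0) hf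

lemma sq (hf : HasGrad3 f p x) : HasGrad3 (fun y => f y ^ 2) ((2 * f x) • p) x := by
  simpa using comp (hasDerivAt_pow 2 (f x)) hf

lemma congr (hf : HasGrad3 f p x) (h : g =ᶠ[nhds x] f) (hpq : ∀ i, q i = p i) :
    HasGrad3 g q x := by
  refine ⟨hf.1.congr_of_eventuallyEq h, fun i => ?_⟩
  rw [pd, h.fderiv_eq, hpq, ← hf.2, pd]

end HasGrad3

lemma rr_sq (x : V3) : rr x ^ 2 = x 0 ^ 2 + x 1 ^ 2 + x 2 ^ 2 :=
  Real.sq_sqrt (by positivity)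

lemma ρ3_sq (x : V3) : ρ3 x ^ 2 = x 0 ^ 2 + x 1 ^ 2 :=
  Real.sq_sqrt (by positivity)

lemma μ3_mem_Ioo {x : V3} (hr : 0 < rr x) (hρ : 0 < ρ3 x) : μ3 x ∈ Set.Ioo (-1 : ℝ) 1 := by
  have h : x 2 ^ 2 < rr x ^ 2 := by
    have := rr_sq x
    have := ρ3_sq x
    nlinarith
  have h' := abs_lt.1 (abs_lt_of_sq_lt_sq h hr.le)
  rw [μ3, Set.mem_Ioo, lt_div_iff₀ hr, div_lt_iff₀ hr]
  constructor <;> linarith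

lemma hasGrad3_rr {x : V3} (hr : 0 < rr x) : HasGrad3 rr (er x) x := by
  have h0 : x 0 ^ 2 + x 1 ^ 2 + x 2 ^ 2 ≠ 0 := by
    rw [← rr_sq]
    positivity
  have h := ((HasGrad3.coord 0 x).sq.add (HasGrad3.coord 1 x).sq).add (HasGrad3.coord 2 x).sq
  refine (HasGrad3.comp (Real.hasDerivAt_sqrt h0) h).congr (.of_forall fun _ => rfl) fun i => ?_
  rw [← rr]
  fin_cases i <;> simp [er] <;> field_simp

lemma hasGrad3_ρ3_sq (x : V3) :
    HasGrad3 (fun y => ρ3 y ^ 2) ![2 * x 0, 2 * x 1, 0] x := by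
  refine ((HasGrad3.coord 0 x).sq.add (HasGrad3.coord 1 x).sq).congr
    (.of_forall ρ3_sq) fun i => ?_
  fin_cases i <;> simp

lemma hasGrad3_μ3 {x : V3} (hr : 0 < rr x) :
    HasGrad3 μ3 ![-(x 2 * x 0) / rr x ^ 3, -(x 2 * x 1) / rr x ^ 3,
      1 / rr x - x 2 ^ 2 / rr x ^ 3] x := by
  refine ((HasGrad3.coord 2 x).mul ((hasGrad3_rr hr).inv hr.ne')).congr
    (.of_forall fun _ => rfl) fun i => ?_
  fin_cases i <;> simp [er] <;> field_simp
  ring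

/-- The gradient of `u(cos θ) / r ^ n`. -/
lemma hasGrad3_comp_μ3_div_rpow {u : ℝ → ℝ} {u' : ℝ} (n : ℝ) {x : V3} (hr : 0 < rr x)
    (hu : HasDerivAt u u' (μ3 x)) :
    HasGrad3 (fun y => u (μ3 y) * (rr y ^ n)⁻¹)
      ![(u' * (-(x 2 * x 0) / rr x ^ 3) - n * u (μ3 x) * x 0 / rr x ^ 2) / rr x ^ n,
        (u' * (-(x 2 * x 1) / rr x ^ 3) - n * u (μ3 x) * x 1 / rr x ^ 2) / rr x ^ n,
        (u' * (1 / rr x - x 2 ^ 2 / rr x ^ 3) - n * u (μ3 x) * x 2 / rr x ^ 2) / rr x ^ n] x := by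
  have hR : rr x ^ n ≠ 0 := (Real.rpow_pos_of_pos hr n).ne'
  have hpow := HasGrad3.comp (Real.hasDerivAt_rpow_const (p := n) (Or.inl hr.ne'))
    (hasGrad3_rr hr)
  refine ((HasGrad3.comp hu (hasGrad3_μ3 hr)).mul (hpow.inv hR)).congr
    (.of_forall fun _ => rfl) fun i => ?_
  rw [Real.rpow_sub_one hr.ne']
  fin_cases i <;> simp [er] <;> field_simp <;> ring

/-- Cartesian components of `(f / (r ^ (n + 1) sin θ)) e_θ + (g / (r ^ (n + 1) sin θ)) e_φ`. -/
lemma polar_add_azimuthal_eq (n f g : ℝ) {x : V3} (hr : 0 < rr x) (hρ : 0 < ρ3 x) :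
    (f / (rr x ^ (n + 1) * sθ3 x)) • eθ x + (g / (rr x ^ (n + 1) * sθ3 x)) • eφ x =
      ![f * (rr x ^ n)⁻¹ * (rr x)⁻¹ * (x 2 * x 0 * (ρ3 x ^ 2)⁻¹)
          - g * (rr x ^ n)⁻¹ * (x 1 * (ρ3 x ^ 2)⁻¹),
        f * (rr x ^ n)⁻¹ * (rr x)⁻¹ * (x 2 * x 1 * (ρ3 x ^ 2)⁻¹)
          + g * (rr x ^ n)⁻¹ * (x 0 * (ρ3 x ^ 2)⁻¹),
        -(f * (rr x ^ n)⁻¹ * (rr x)⁻¹)] := by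
  have hR : rr x ^ n ≠ 0 := (Real.rpow_pos_of_pos hr n).ne'
  ext i
  fin_cases i <;> simp [eθ, eφ, sθ3, Real.rpow_add_one hr.ne'] <;> field_simp
  ring

/-- the Low (1990) axisymmetric nonlinear force-free field:
`∇×A = B` on the region `r > 0`, `0 < θ < π`, and `A·B = 0` there. -/
theorem low_field_vector_potential (n a : ℝ) (hn : 0 < n) (P : ℝ → ℝ)
    (hP : ContDiffOn ℝ 2 P (Set.Ioo (-1 : ℝ) 1))
    (hPpos : ∀ μ ∈ Set.Ioo (-1 : ℝ) 1, 0 < P μ)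
    (A B : V3 → V3)
    (hA : ∀ x, A x =
        (-(a / n) * P (μ3 x) ^ ((n + 1) / n) / (rr x ^ (n + 1) * sθ3 x)) • eθ x
      + (P (μ3 x) / (rr x ^ (n + 1) * sθ3 x)) • eφ x)
    (hB : ∀ x, B x =
        (-(deriv P (μ3 x)) / rr x ^ (n + 2)) • er x
      + (n * P (μ3 x) / (rr x ^ (n + 2) * sθ3 x)) • eθ x
      + (a * P (μ3 x) ^ ((n + 1) / n) / (rr x ^ (n + 2) * sθ3 x)) • eφ x) :
    ∀ x : V3, 0 < rr x → 0 < ρ3 x →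
      curl3 A x = B x ∧ dot3 (A x) (B x) = 0 := by
  intro x hr hρ
  have hμ := μ3_mem_Ioo hr hρ
  have hP' : HasDerivAt P (deriv P (μ3 x)) (μ3 x) :=
    ((hP.contDiffAt (isOpen_Ioo.mem_nhds hμ)).differentiableAt two_ne_zero).hasDerivAt
  have hQ := (hP'.rpow_const (p := (n + 1) / n) (Or.inl (hPpos _ hμ).ne')).const_mul (-(a / n))
  generalize deriv P (μ3 x) * ((n + 1) / n) * P (μ3 x) ^ ((n + 1) / n - 1) = Q' at hQ
  have hf := hasGrad3_comp_μ3_div_rpow n hr hQ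
  have hg := hasGrad3_comp_μ3_div_rpow n hr hP'
  have hq := (hasGrad3_ρ3_sq x).inv (pow_pos hρ 2).ne'
  have hi := (hasGrad3_rr hr).inv hr.ne'
  have hx := fun i => HasGrad3.coord i x
  have hev : ∀ᶠ y in nhds x, 0 < rr y ∧ 0 < ρ3 y := by
    filter_upwards [(hasGrad3_rr hr).1.continuousAt.eventually (lt_mem_nhds hr),
      (hasGrad3_ρ3_sq x).1.continuousAt.eventually (lt_mem_nhds (pow_pos hρ 2))] with y h1 h2
    exact ⟨h1, (show 0 ≤ ρ3 y from Real.sqrt_nonneg _).lt_of_ne' (sq_pos_iff.1 h2)⟩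
  have hcomp : ∀ y, 0 < rr y ∧ 0 < ρ3 y → A y = _ := fun y hy =>
    (hA y).trans (polar_add_azimuthal_eq n _ _ hy.1 hy.2)
  have hA0 := (((hf.mul hi).mul (((hx 2).mul (hx 0)).mul hq)).sub
    (hg.mul ((hx 1).mul hq))).congr (g := fun y => A y 0)
    (hev.mono fun y hy => congrFun (hcomp y hy) 0) fun _ => rfl
  have hA1 := (((hf.mul hi).mul (((hx 2).mul (hx 1)).mul hq)).add
    (hg.mul ((hx 0).mul hq))).congr (g := fun y => A y 1)
    (hev.mono fun y hy => congrFun (hcomp y hy) 1) fun _ => rfl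
  have hA2 := (hf.mul hi).neg.congr (g := fun y => A y 2)
    (hev.mono fun y hy => congrFun (hcomp y hy) 2) fun _ => rfl
  have hR := Real.rpow_pos_of_pos hr n
  have hpow : rr x ^ (n + 2) = rr x ^ n * rr x ^ 2 := by
    rw [Real.rpow_add hr, Real.rpow_two]
  have hzr : rr x ^ 2 = ρ3 x ^ 2 + x 2 ^ 2 := by rw [rr_sq, ρ3_sq]
  have hρs := ρ3_sq x
  have hρz : ρ3 x ^ 2 = rr x ^ 2 - x 2 ^ 2 := by rw [hzr, add_sub_cancel_right]
  constructor
  · rw [hB, curl3, hA0.2, hA0.2, hA1.2, hA1.2, hA2.2, hA2.2, hpow]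
    generalize P (μ3 x) ^ ((n + 1) / n) = Q
    generalize P (μ3 x) = P0
    generalize deriv P (μ3 x) = P'
    generalize rr x ^ n = R at hR ⊢
    ext i
    fin_cases i <;>
      simp only [Fin.zero_eta, Fin.mk_one, Fin.reduceFinMk, Matrix.cons_val, er, eθ, eφ, sθ3,
        Pi.add_apply, Pi.sub_apply, Pi.neg_apply, Pi.smul_apply, smul_eq_mul, Pi.single_apply] <;>
      simp <;> field_simp
    · rw [hρz]
      ring
    · rw [hρz]
      ring
    · linear_combination n * rr x * (2 * rr x ^ 3 * P0 + ρ3 x ^ 2 * (x 2 * P' + n * rr x * P0)) * hρs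
  · rw [hcomp x ⟨hr, hρ⟩, hB, hpow]
    generalize P (μ3 x) ^ ((n + 1) / n) = Q
    simp only [dot3, Matrix.cons_val, er, eθ, eφ, sθ3,
      Pi.add_apply, Pi.smul_apply, smul_eq_mul]
    field_simp
    linear_combination ρ3 x ^ 2 * a * Q * n * rr x * P (μ3 x) * hzr
      + a * Q * (x 2 * (n * rr x * x 2 * P (μ3 x) - ρ3 x ^ 2 * deriv P (μ3 x))
        - n * rr x ^ 3 * P (μ3 x)) * hρs
end
end

section
/- Let u, A : ℝ × ℝ³ → ℝ³ and ζ : ℝ × ℝ³ → ℝ be C² fields with |A| > 0, set B = ∇×A, h_m = A·B, β = h_m/|A|², η = (A×B)/|A|², Â = A/|A|, and suppose A satisfies dA/dt + (A·∇)u + A×(∇×u) + ∇ζ = 0 where d/dt = ∂/∂t + u·∇ (the un-curled Faraday equation) and h_m satisfies ∂h_m/∂t + ∇·(u h_m + ζ B) = 0. Then the field G = ∂(βA)/∂t − ∇×(u×(βA)) + u ∇·(βA) decomposes into components parallel and perpendicular to A as G = G_∥ + G_⊥ with G_∥ = −(A/|A|²) (η×A)·∇ζ and G_⊥ = (h_m/|A|⁴)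 A×[ A×( 2 σ·A + ∇ζ ) ], where σ is the shear tensor of u. -/
noncomputable section

/-- Spatial partial derivative of a time-dependent scalar field. -/
def pdS (i : Fin 3) (f : ℝ × V3 → ℝ) (p : ℝ × V3) : ℝ :=
  fderiv ℝ (fun x => f (p.1, x)) p.2 (Pi.single i 1)

/-- Spatial gradient of a time-dependent scalar field. -/
def gradS (f : ℝ × V3 → ℝ) (p : ℝ × V3) : V3 := fun i => pdS i f p

/-- Spatial divergence of a time-dependent vector field. -/
def divS (F : ℝ × V3 → V3) (p : ℝ × V3) : ℝ :=
  pdS 0 (fun q => F q 0) p + pdS 1 (fun q => F q 1) p + pdS 2 (fun q => F q 2) p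

/-- Spatial curl of a time-dependent vector field. -/
def curlS (F : ℝ × V3 → V3) (p : ℝ × V3) : V3 :=
  ![pdS 1 (fun q => F q 2) p - pdS 2 (fun q => F q 1) p,
    pdS 2 (fun q => F q 0) p - pdS 0 (fun q => F q 2) p,
    pdS 0 (fun q => F q 1) p - pdS 1 (fun q => F q 0) p]

/-- Time partial derivative of a scalar field. -/
def dtS (f : ℝ × V3 → ℝ) (p : ℝ × V3) : ℝ := deriv (fun t => f (t, p.2)) p.1

/-- Time partial derivative of a vector field. -/
def dtV (F : ℝ × V3 → V3) (p : ℝ × V3) : V3 := deriv (fun t => F (t, p.2)) p.1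

/-- Fluid shear tensor `σ_ij = ½(∂u_i/∂x_j + ∂u_j/∂x_i) − (1/3) δ_ij ∇·u`. -/
def shearS (u : ℝ × V3 → V3) (p : ℝ × V3) : Fin 3 → Fin 3 → ℝ :=
  fun i j => (1 / 2) * (pdS j (fun q => u q i) p + pdS i (fun q => u q j) p)
    - (1 / 3) * (if i = j then (1 : ℝ) else 0) * divS u p

/-- Matrix–vector product `(m·v)_i = Σ_j m_ij v_j`. -/
def matVec (m : Fin 3 → Fin 3 → ℝ) (v : V3) : V3 := fun i => ∑ j : Fin 3, m i j * v j

/-- Quadratic form `a·m·b = Σ_{i,j} a_i m_ij b_j`. -/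
def quad3 (a : V3) (m : Fin 3 → Fin 3 → ℝ) (b : V3) : ℝ :=
  ∑ i : Fin 3, ∑ j : Fin 3, a i * m i j * b j

/-- Directional derivative `(v·∇)F` in the spatial variables. -/
def dirDS (v : V3) (F : ℝ × V3 → V3) (p : ℝ × V3) : V3 :=
  fun i => v 0 * pdS 0 (fun q => F q i) p + v 1 * pdS 1 (fun q => F q i) p
    + v 2 * pdS 2 (fun q => F q i) p

section PartialDerivatives

variable {f g : ℝ × V3 → ℝ} {F : ℝ × V3 → V3} {p : ℝ × V3}

theorem pdS_eq_fderiv (i : Fin 3) (hf : DifferentiableAt ℝ f p) :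
    pdS i f p = fderiv ℝ f p (0, Pi.single i 1) := by
  have h : HasFDerivAt (fun x : V3 => f (p.1, x))
      ((fderiv ℝ f p).comp (ContinuousLinearMap.inr ℝ ℝ V3)) p.2 :=
    HasFDerivAt.comp p.2 (f := fun x : V3 => (p.1, x)) hf.hasFDerivAt
      (hasFDerivAt_prodMk_right p.1 p.2)
  simp [pdS, h.fderiv]

theorem dtS_eq_fderiv (hf : DifferentiableAt ℝ f p) :
    dtS f p = fderiv ℝ f p (1, 0) := by
  have h : HasFDerivAt (fun t : ℝ => f (t, p.2))
      ((fderiv ℝ f p).comp (ContinuousLinearMap.inl ℝ ℝ V3)) p.1 :=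
    HasFDerivAt.comp p.1 (f := fun t : ℝ => (t, p.2)) hf.hasFDerivAt
      (hasFDerivAt_prodMk_left p.1 p.2)
  simp [dtS, h.hasDerivAt.deriv]

theorem pdS_add (i : Fin 3) (hf : DifferentiableAt ℝ f p) (hg : DifferentiableAt ℝ g p) :
    pdS i (fun q => f q + g q) p = pdS i f p + pdS i g p := by
  rw [pdS_eq_fderiv i (hf.fun_add hg), pdS_eq_fderiv i hf, pdS_eq_fderiv i hg, fderiv_fun_add hf hg]
  rfl

theorem pdS_sub (i : Fin 3) (hf : DifferentiableAt ℝ f p) (hg : DifferentiableAt ℝ g p) :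
    pdS i (fun q => f q - g q) p = pdS i f p - pdS i g p := by
  rw [pdS_eq_fderiv i (hf.fun_sub hg), pdS_eq_fderiv i hf, pdS_eq_fderiv i hg, fderiv_fun_sub hf hg]
  rfl

theorem pdS_mul (i : Fin 3) (hf : DifferentiableAt ℝ f p) (hg : DifferentiableAt ℝ g p) :
    pdS i (fun q => f q * g q) p = f p * pdS i g p + g p * pdS i f p := by
  rw [pdS_eq_fderiv i (hf.fun_mul hg), pdS_eq_fderiv i hf, pdS_eq_fderiv i hg, fderiv_fun_mul hf hg]
  rfl

theorem dtS_add (hf : DifferentiableAt ℝ f p) (hg : DifferentiableAt ℝ g p) :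
    dtS (fun q => f q + g q) p = dtS f p + dtS g p := by
  rw [dtS_eq_fderiv (hf.fun_add hg), dtS_eq_fderiv hf, dtS_eq_fderiv hg, fderiv_fun_add hf hg]
  rfl

theorem dtS_mul (hf : DifferentiableAt ℝ f p) (hg : DifferentiableAt ℝ g p) :
    dtS (fun q => f q * g q) p = f p * dtS g p + g p * dtS f p := by
  rw [dtS_eq_fderiv (hf.fun_mul hg), dtS_eq_fderiv hf, dtS_eq_fderiv hg, fderiv_fun_mul hf hg]
  rfl

theorem dtV_apply (hF : DifferentiableAt ℝ F p) (i : Fin 3) :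
    dtV F p i = dtS (fun q => F q i) p := by
  have h : DifferentiableAt ℝ (fun t : ℝ => F (t, p.2)) p.1 :=
    DifferentiableAt.comp p.1 (f := fun t : ℝ => (t, p.2)) hF (by fun_prop)
  rw [dtV, deriv_pi (fun j => differentiableAt_pi.1 h j)]
  rfl

theorem contDiff_pdS (i : Fin 3) (hf : ContDiff ℝ 2 f) : ContDiff ℝ 1 (pdS i f) := by
  have h : pdS i f = fun q => fderiv ℝ f q (0, Pi.single i 1) :=
    funext fun q => pdS_eq_fderiv i (hf.differentiable (by norm_num) q)
  rw [h]
  exact (hf.fderiv_right (m := 1) (by norm_num)).clm_apply contDiff_const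

theorem pdS_comm (i j : Fin 3) (hf : ContDiff ℝ 2 f) :
    pdS i (pdS j f) p = pdS j (pdS i f) p := by
  have h1 : Differentiable ℝ (fderiv ℝ f) :=
    (hf.fderiv_right (m := 1) (by norm_num)).differentiable (by norm_num)
  have key : ∀ k l : Fin 3, pdS k (pdS l f) p =
      fderiv ℝ (fderiv ℝ f) p (0, Pi.single k 1) (0, Pi.single l 1) := by
    intro k l
    have h : pdS l f = fun q => fderiv ℝ f q (0, Pi.single l 1) :=
      funext fun q => pdS_eq_fderiv l (hf.differentiable (by norm_num) q)
    rw [pdS_eq_fderiv k ((contDiff_pdS l hf).differentiable (by norm_num) p), h,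
      fderiv_clm_apply (h1 p) (differentiableAt_const _)]
    simp
  rw [key, key]
  exact (hf.contDiffAt.isSymmSndFDerivAt (by simp)).eq _ _

theorem divS_curlS (hF : ContDiff ℝ 2 F) : divS (curlS F) p = 0 := by
  have hc : ∀ i, ContDiff ℝ 2 (fun q => F q i) := fun i => contDiff_pi.1 hF i
  have hd : ∀ i j, DifferentiableAt ℝ (fun q => pdS i (fun r => F r j) q) p := fun i j =>
    (contDiff_pdS i (hc j)).differentiable (by norm_num) p
  simp only [divS, curlS, Matrix.cons_val_zero, Matrix.cons_val_one, Matrix.cons_val]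
  rw [pdS_sub 0 (hd _ _) (hd _ _), pdS_sub 1 (hd _ _) (hd _ _), pdS_sub 2 (hd _ _) (hd _ _)]
  linarith [pdS_comm (p := p) 0 1 (hc 2), pdS_comm (p := p) 0 2 (hc 1),
    pdS_comm (p := p) 1 2 (hc 0)]

theorem contDiff_curlS (hF : ContDiff ℝ 2 F) : ContDiff ℝ 1 (curlS F) := by
  have hc : ∀ i j, ContDiff ℝ 1 (pdS i (fun q => F q j)) := fun i j =>
    contDiff_pdS i (contDiff_pi.1 hF j)
  refine contDiff_pi.2 fun i => ?_
  fin_cases i <;> exact (hc _ _).sub (hc _ _)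

theorem divS_smul (hf : DifferentiableAt ℝ f p) (hF : DifferentiableAt ℝ F p) :
    divS (fun q => f q • F q) p = f p * divS F p + dot3 (F p) (gradS f p) := by
  have hc := differentiableAt_pi.1 hF
  simp only [divS, Pi.smul_apply, smul_eq_mul, dot3, gradS]
  rw [pdS_mul 0 hf (hc 0), pdS_mul 1 hf (hc 1), pdS_mul 2 hf (hc 2)]
  ring

theorem divS_add {H : ℝ × V3 → V3} (hF : DifferentiableAt ℝ F p) (hH : DifferentiableAt ℝ H p) :
    divS (fun q => F q + H q) p = divS F p + divS H p := by
  have hc := differentiableAt_pi.1 hF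
  have hd := differentiableAt_pi.1 hH
  simp only [divS, Pi.add_apply]
  rw [pdS_add 0 (hc 0) (hd 0), pdS_add 1 (hc 1) (hd 1), pdS_add 2 (hc 2) (hd 2)]
  ring

/-- The curl of a cross product: `∇×(F×H) = F ∇·H − H ∇·F + (H·∇)F − (F·∇)H`. -/
theorem curlS_cross3 {H : ℝ × V3 → V3} (hF : DifferentiableAt ℝ F p)
    (hH : DifferentiableAt ℝ H p) :
    curlS (fun q => cross3 (F q) (H q)) p =
      divS H p • F p - divS F p • H p + dirDS (H p) F p - dirDS (F p) H p := by
  have hc := differentiableAt_pi.1 hF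
  have hd := differentiableAt_pi.1 hH
  have key : ∀ k i j, pdS k (fun q => F q i * H q j - F q j * H q i) p =
      F p i * pdS k (fun q => H q j) p + H p j * pdS k (fun q => F q i) p
      - (F p j * pdS k (fun q => H q i) p + H p i * pdS k (fun q => F q j) p) := by
    intro k i j
    rw [pdS_sub k ((hc i).fun_mul (hd j)) ((hc j).fun_mul (hd i)), pdS_mul k (hc i) (hd j),
      pdS_mul k (hc j) (hd i)]
  ext i
  fin_cases i <;> simp [curlS, cross3, divS, dirDS, key] <;> ring

end PartialDerivatives

theorem norm3_sq (a : V3) : norm3 a ^ 2 = dot3 a a :=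
  Real.sq_sqrt (by simp only [dot3]; nlinarith [mul_self_nonneg (a 0), mul_self_nonneg (a 1),
    mul_self_nonneg (a 2)])

/-- The Lagrangian derivative of a scalar field along `u`. -/
def lagrangianS (u : ℝ × V3 → V3) (f : ℝ × V3 → ℝ) (p : ℝ × V3) : ℝ :=
  dtS f p + dot3 (u p) (gradS f p)

section Lagrangian

variable {u F : ℝ × V3 → V3} {f g : ℝ × V3 → ℝ} {p : ℝ × V3}

theorem lagrangianS_add (hf : DifferentiableAt ℝ f p) (hg : DifferentiableAt ℝ g p) :
    lagrangianS u (fun q => f q + g q) p = lagrangianS u f p + lagrangianS u g p := by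
  simp only [lagrangianS, dot3, gradS, dtS_add hf hg, pdS_add _ hf hg]
  ring

theorem lagrangianS_mul (hf : DifferentiableAt ℝ f p) (hg : DifferentiableAt ℝ g p) :
    lagrangianS u (fun q => f q * g q) p =
      f p * lagrangianS u g p + g p * lagrangianS u f p := by
  simp only [lagrangianS, dot3, gradS, dtS_mul hf hg, pdS_mul _ hf hg]
  ring

theorem lagrangianS_dot3_self (hF : DifferentiableAt ℝ F p) :
    lagrangianS u (fun q => dot3 (F q) (F q)) p =
      2 * dot3 (F p) (fun i => lagrangianS u (fun q => F q i) p) := by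
  have hc := differentiableAt_pi.1 hF
  have hm : ∀ i, DifferentiableAt ℝ (fun q => F q i * F q i) p := fun i => (hc i).fun_mul (hc i)
  simp only [dot3]
  rw [lagrangianS_add ((hm 0).fun_add (hm 1)) (hm 2), lagrangianS_add (hm 0) (hm 1),
    lagrangianS_mul (hc 0) (hc 0), lagrangianS_mul (hc 1) (hc 1), lagrangianS_mul (hc 2) (hc 2)]
  ring

/-- The field `∂F/∂t − ∇×(u×F) + u ∇·F` in advective form. -/
theorem induction_eq_lagrangianS (hu : DifferentiableAt ℝ u p) (hF : DifferentiableAt ℝ F p)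
    (i : Fin 3) :
    (dtV F p - curlS (fun q => cross3 (u q) (F q)) p + divS F p • u p) i =
      lagrangianS u (fun q => F q i) p - dirDS (F p) u p i + F p i * divS u p := by
  rw [curlS_cross3 hu hF]
  simp only [Pi.add_apply, Pi.sub_apply, Pi.smul_apply, smul_eq_mul, dtV_apply hF, lagrangianS,
    dirDS, dot3, gradS]
  ring

end Lagrangian

/-- decomposition of the term `G = ∂(βA)/∂t − ∇×(u×(βA)) + u ∇·(βA)`
into components parallel and perpendicular to `A`:
`G_∥ = (G·Â)Â = −(A/|A|²)(η×A)·∇ζ` and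
`G_⊥ = G − (G·Â)Â = (h_m/|A|⁴) A×[A×(2σ·A + ∇ζ)]`. -/
theorem G_parallel_perpendicular_decomposition
    (u A : ℝ × V3 → V3) (ζ : ℝ × V3 → ℝ)
    (hu : ContDiff ℝ 2 u) (hA : ContDiff ℝ 2 A) (hζ : ContDiff ℝ 2 ζ)
    (hpos : ∀ p, 0 < norm3 (A p))
    (B η G Ahat : ℝ × V3 → V3) (hm β : ℝ × V3 → ℝ)
    (hB : ∀ p, B p = curlS A p)
    (hhm : ∀ p, hm p = dot3 (A p) (B p))
    (hβ : ∀ p, β p = hm p / norm3 (A p) ^ 2)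
    (hη : ∀ p, η p = (norm3 (A p) ^ 2)⁻¹ • cross3 (A p) (B p))
    (hAhat : ∀ p, Ahat p = (norm3 (A p))⁻¹ • A p)
    (hFaraday : ∀ p, (dtV A p + dirDS (u p) A p) + dirDS (A p) u p
        + cross3 (A p) (curlS u p) + gradS ζ p = 0)
    (hHelicity : ∀ p, dtS hm p + divS (fun q => hm q • u q + ζ q • B q) p = 0)
    (hG : ∀ p, G p = dtV (fun q => β q • A q) p
        - curlS (fun q => cross3 (u q) (β q • A q)) p
        + divS (fun q => β q • A q) p • u p) :
    ∀ p : ℝ × V3,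
      (dot3 (G p) (Ahat p)) • Ahat p
          = -((dot3 (cross3 (η p) (A p)) (gradS ζ p)) / norm3 (A p) ^ 2) • A p
      ∧ G p - (dot3 (G p) (Ahat p)) • Ahat p
          = (hm p / norm3 (A p) ^ 4) •
              cross3 (A p) (cross3 (A p)
                ((2 : ℝ) • matVec (shearS u p) (A p) + gradS ζ p)) := by
  intro p
  have hu' : DifferentiableAt ℝ u p := hu.differentiable (by norm_num) p
  have hA' : Differentiable ℝ A := hA.differentiable (by norm_num)
  have hζ' : DifferentiableAt ℝ ζ p := hζ.differentiable (by norm_num) p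
  have hBc : B = curlS A := funext hB
  have hB' : Differentiable ℝ B := by
    rw [hBc]; exact (contDiff_curlS hA).differentiable (by norm_num)
  have hAi := fun i => differentiableAt_pi.1 (hA' p) i
  have hBi := fun i => differentiableAt_pi.1 (hB' p) i
  have hhm' : DifferentiableAt ℝ hm p := by
    rw [funext hhm]
    exact (((hAi 0).fun_mul (hBi 0)).fun_add ((hAi 1).fun_mul (hBi 1))).fun_add
      ((hAi 2).fun_mul (hBi 2))
  have hN : DifferentiableAt ℝ (fun q => dot3 (A q) (A q)) p :=
    (((hAi 0).fun_mul (hAi 0)).fun_add ((hAi 1).fun_mul (hAi 1))).fun_add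
      ((hAi 2).fun_mul (hAi 2))
  have hN0 : ∀ q, dot3 (A q) (A q) ≠ 0 := fun q => by
    rw [← norm3_sq]; exact pow_ne_zero _ (hpos q).ne'
  have hβ' : DifferentiableAt ℝ β p := by
    have : β = fun q => hm q / dot3 (A q) (A q) := funext fun q => by rw [hβ, norm3_sq]
    rw [this]
    simpa only [div_eq_mul_inv] using hhm'.fun_mul (hN.fun_inv (hN0 p))
  have hhβ : hm = fun q => β q * dot3 (A q) (A q) := funext fun q => by
    rw [hβ, norm3_sq, div_mul_cancel₀ _ (hN0 q)]
  have hDh : lagrangianS u hm p = -hm p * divS u p - dot3 (B p) (gradS ζ p) := by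
    have h := hHelicity p
    rw [divS_add (hhm'.fun_smul hu') (hζ'.fun_smul (hB' p)), divS_smul hhm' hu',
      divS_smul hζ' (hB' p), hBc, divS_curlS hA, ← hBc] at h
    rw [lagrangianS]
    linarith
  have hDβ : β p * (2 * dot3 (A p) (fun i => lagrangianS u (fun q => A q i) p))
      + dot3 (A p) (A p) * lagrangianS u β p
      = -hm p * divS u p - dot3 (B p) (gradS ζ p) := by
    rw [← hDh, ← lagrangianS_dot3_self (hA' p), ← lagrangianS_mul hβ' hN, ← hhβ]
  have hDA : ∀ i, lagrangianS u (fun q => A q i) p =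
      -dot3 (A p) (fun j => pdS i (fun q => u q j) p) - pdS i ζ p := by
    intro i
    have h := congrFun (hFaraday p) i
    simp only [Pi.add_apply, dtV_apply (hA' p), Pi.zero_apply] at h
    rw [lagrangianS]
    fin_cases i <;> simp [dirDS, cross3, curlS, gradS, dot3] at h ⊢ <;> linarith
  have hGi : ∀ i, G p i = β p * lagrangianS u (fun q => A q i) p + A p i * lagrangianS u β p
      - β p * dirDS (A p) u p i + β p * A p i * divS u p := by
    intro i
    rw [hG, induction_eq_lagrangianS hu' (hβ'.fun_smul (hA' p))]
    simp only [Pi.smul_apply, smul_eq_mul]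
    rw [lagrangianS_mul hβ' (hAi i)]
    simp only [dirDS, Pi.smul_apply, smul_eq_mul]
    ring
  have hn := (hpos p).ne'
  have hn2 := norm3_sq (A p)
  have hβp := hβ p
  have hhp := hhm p
  have hGA : dot3 (G p) (A p) = β p * dot3 (A p) (gradS ζ p) - dot3 (B p) (gradS ζ p) := by
    have hβN := congrFun hhβ p
    simp only [dot3, dirDS, hDA, hGi, gradS] at hDβ hβN ⊢
    linear_combination hDβ - divS u p * hβN
  have hGhat : dot3 (G p) (Ahat p) = dot3 (G p) (A p) / norm3 (A p) := by
    simp only [hAhat, dot3, Pi.smul_apply, smul_eq_mul]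
    field_simp
  have hpar : dot3 (G p) (Ahat p) • Ahat p = (dot3 (G p) (A p) / norm3 (A p) ^ 2) • A p := by
    rw [hGhat, hAhat, smul_smul]
    congr 1
    field_simp
  have hηA : dot3 (cross3 (η p) (A p)) (gradS ζ p) = -dot3 (G p) (A p) := by
    rw [hGA, hβp, hhp, hη]
    simp [cross3, dot3] at hn2 ⊢
    field_simp
    simp only [hn2]
    ring
  refine ⟨by rw [hpar, hηA, neg_div, neg_neg], ?_⟩
  have hh : hm p / norm3 (A p) ^ 4 = β p / norm3 (A p) ^ 2 := by
    rw [hβp]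
    field_simp
  have hDβ' : norm3 (A p) ^ 2 * lagrangianS u β p
      = -hm p * divS u p - dot3 (B p) (gradS ζ p)
        - β p * (2 * dot3 (A p) (fun i => lagrangianS u (fun q => A q i) p)) := by
    rw [hn2]
    linarith
  have hβN : hm p = β p * norm3 (A p) ^ 2 := by rw [hn2]; exact congrFun hhβ p
  rw [hpar, hh, hGA]
  ext i
  simp only [dot3, hDA] at hDβ'
  rw [Pi.sub_apply, Pi.smul_apply, Pi.smul_apply, smul_eq_mul, smul_eq_mul, hGi, hDA]
  rw [← mul_right_inj' (pow_ne_zero 2 hn)]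
  have hcancel : ∀ x y : ℝ, norm3 (A p) ^ 2 * (x / norm3 (A p) ^ 2 * y) = x * y := fun x y => by
    field_simp
  rw [mul_sub, hcancel, hcancel]
  simp only [dot3] at hn2
  fin_cases i <;>
    simp [cross3, dot3, dirDS, matVec, shearS, Fin.sum_univ_three, gradS] at hDβ' ⊢
  · linear_combination A p 0 * hDβ' - A p 0 * divS u p * hβN - β p * hn2 *
      (A p 0 * (pdS 0 (fun q => u q 0) p + pdS 0 (fun q => u q 0) p) +
        A p 1 * (pdS 0 (fun q => u q 1) p + pdS 1 (fun q => u q 0) p) +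
        A p 2 * (pdS 0 (fun q => u q 2) p + pdS 2 (fun q => u q 0) p) + pdS 0 ζ p)
  · linear_combination A p 1 * hDβ' - A p 1 * divS u p * hβN - β p * hn2 *
      (A p 0 * (pdS 1 (fun q => u q 0) p + pdS 0 (fun q => u q 1) p) +
        A p 1 * (pdS 1 (fun q => u q 1) p + pdS 1 (fun q => u q 1) p) +
        A p 2 * (pdS 1 (fun q => u q 2) p + pdS 2 (fun q => u q 1) p) + pdS 1 ζ p)
  · linear_combination A p 2 * hDβ' - A p 2 * divS u p * hβN - β p * hn2 *
      (A p 0 * (pdS 2 (fun q => u q 0) p + pdS 0 (fun q => u q 2) p) +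
        A p 1 * (pdS 2 (fun q => u q 1) p + pdS 1 (fun q => u q 2) p) +
        A p 2 * (pdS 2 (fun q => u q 2) p + pdS 2 (fun q => u q 2) p) + pdS 2 ζ p)
end
end
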